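/- arXiv:2111.03334 — 2 statements merged into one kernel-verified Lean document; each statement's English description precedes it below -/
import Mathlib

section
/- Monomial functional equation with a twist (the computational core of the paper's Lemma on the Bernstein–Sato polynomial after resolution). Let f_j = ∏_{i=1}^n x_i^{e_{ij}} be monomials with e_{ij} ∈ ℕ, let k = (k_1,…,k_n) ∈ ℕ^n, let a ∈ ℕ^r, and set m_i := ∑_{j=1}^r a_j·e_{ij} for i = 1,…,n. Then in the twisted module M the identity (∇_1^{m_1} ∘ ⋯ ∘ ∇_n^{m_n})( x_1^{k_1}⋯x_n^{k_n} · F^{s+a} ) = q(s) · x_1^{k_1}⋯x_n^{k_n} · F^s holds, where q(s) := ∏_{i=1}^n ∏_{c=1}^{m_i} ( ∑_{j=1}^r e_{ij}·s_j + k_i + c ). In particular q(s)·x^k·F^s lies in the smallest ℂ[x_1,…,x_n,s_1,…,s_r]-submodule of M containing x^k·F^{s+a} and stable under ∇_1,…,∇_n. -/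
open MvPolynomial MeasureTheory

noncomputable section

/-- The polynomial ring `K0[x_1,…,x_n,s_1,…,s_r]`, with the `x`-variables indexed by
`Sum.inl` and the `s`-variables indexed by `Sum.inr`. -/
abbrev XS (K0 : Type) [Field K0] (n r : ℕ) : Type := MvPolynomial (Fin n ⊕ Fin r) K0

/-- The fraction field of `K0[x,s]`; the localization `K0[x,s][1/f]` sits inside it, and the
smallest `∇`-stable submodule generated by an element is the same computed in either. -/
abbrev Frac (K0 : Type) [Field K0] (n r : ℕ) : Type := FractionRing (XS K0 n r)

variable (K0 : Type) [Field K0] (n r : ℕ)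

/-- Embedding of `K0[x_1,…,x_n]` into `K0[x,s]`. -/
def px (p : MvPolynomial (Fin n) K0) : XS K0 n r := rename Sum.inl p

/-- Embedding of `K0[s_1,…,s_r]` into `K0[x,s]`. -/
def ps (p : MvPolynomial (Fin r) K0) : XS K0 n r := rename Sum.inr p

/-- The canonical map from `K0[x,s]` to its fraction field. -/
def toF (p : XS K0 n r) : Frac K0 n r := algebraMap _ _ p

/-- The partial derivative `∂/∂x_i`, extended to the fraction field of `K0[x,s]` via the
quotient rule applied to a representative fraction (the formula is independent of the chosen
representative, so this is the unique derivation extending `pderiv (Sum.inl i)`). -/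
def DX (i : Fin n) (q : Frac K0 n r) : Frac K0 n r :=
  let h := IsFractionRing.div_surjective (A := XS K0 n r) q
  (toF K0 n r (pderiv (Sum.inl i) h.choose) * toF K0 n r h.choose_spec.choose -
      toF K0 n r h.choose * toF K0 n r (pderiv (Sum.inl i) h.choose_spec.choose)) /
    toF K0 n r h.choose_spec.choose ^ 2

/-- The logarithmic twist `∑_j s_j · (∂f_j/∂x_i)/f_j` in the fraction field. -/
def twist (f : Fin r → MvPolynomial (Fin n) K0) (i : Fin n) : Frac K0 n r :=
  ∑ j, toF K0 n r (X (Sum.inr j)) * toF K0 n r (px K0 n r (pderiv i (f j))) /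
    toF K0 n r (px K0 n r (f j))

/-- The twisted partial derivative `∇_i(g·F^s) = (∂g/∂x_i + g·∑_j s_j (∂f_j/∂x_i)/f_j)·F^s`,
the formal action of `∂/∂x_i` on `g·f_1^{s_1}⋯f_r^{s_r}`; here `g·F^s` is identified with `g`. -/
def nabla (f : Fin r → MvPolynomial (Fin n) K0) (i : Fin n) (g : Frac K0 n r) : Frac K0 n r :=
  DX K0 n r i g + g * twist K0 n r f i

/-- The element `F^{s+a} = (f_1^{a_1}⋯f_r^{a_r})·F^s`, where `F^s` is identified with `1`. -/
def Fsa (f : Fin r → MvPolynomial (Fin n) K0) (a : Fin r → ℕ) : Frac K0 n r :=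
  toF K0 n r (∏ j, px K0 n r (f j) ^ a j)

/-- The smallest `K0[x,s]`-submodule containing `F^{s+a}` and stable under `∇_1,…,∇_n`,
realizing `𝒟[s]·F^{s+a}`. -/
def Na (f : Fin r → MvPolynomial (Fin n) K0) (a : Fin r → ℕ) :
    Submodule (XS K0 n r) (Frac K0 n r) :=
  sInf {N | Fsa K0 n r f a ∈ N ∧ ∀ i : Fin n, ∀ m ∈ N, nabla K0 n r f i m ∈ N}

/-- The Bernstein–Sato ideal `B_F^a = { b ∈ K0[s] : b·F^s ∈ N_a }` (as a set of polynomials). -/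
def BS (f : Fin r → MvPolynomial (Fin n) K0) (a : Fin r → ℕ) : Set (MvPolynomial (Fin r) K0) :=
  {b | toF K0 n r (ps K0 n r b) ∈ Na K0 n r f a}

/-- The zero locus `Z(B_F^a) ⊆ ℂ^r` of the Bernstein–Sato ideal. -/
def ZBS (f : Fin r → MvPolynomial (Fin n) ℂ) (a : Fin r → ℕ) : Set (Fin r → ℂ) :=
  {α | ∀ b ∈ BS ℂ n r f a, eval α b = 0}

end

noncomputable section

/-- The composite `∇₁^{m₁} ∘ ⋯ ∘ ∇ₙ^{mₙ}` of iterated twisted partial derivatives. -/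
def iterNabla (n r : ℕ) (f : Fin r → MvPolynomial (Fin n) ℂ) (m : Fin n → ℕ) :
    Frac ℂ n r → Frac ℂ n r :=
  (List.ofFn (fun i : Fin n => (nabla ℂ n r f i)^[m i])).foldr (· ∘ ·) id

/-- The chosen-representative quotient rule restricts to the partial derivative on polynomials. -/
lemma DX_toF (n r : ℕ) (i : Fin n) (p : XS ℂ n r) :
    DX ℂ n r i (toF ℂ n r p) = toF ℂ n r (pderiv (Sum.inl i) p) := by
  unfold DX
  extract_lets h
  have hne : toF ℂ n r h.choose_spec.choose ≠ 0 := by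
    simpa [toF] using nonZeroDivisors.ne_zero h.choose_spec.choose_spec.1
  have heq : toF ℂ n r h.choose / toF ℂ n r h.choose_spec.choose = toF ℂ n r p :=
    h.choose_spec.choose_spec.2
  generalize h.choose_spec.choose = d at *
  generalize h.choose = u at *
  rw [div_eq_iff hne] at heq
  have hu : u = p * d := by
    apply IsFractionRing.injective (XS ℂ n r) (Frac ℂ n r)
    simpa [toF] using heq
  subst hu
  rw [div_eq_iff (pow_ne_zero 2 hne)]
  simp only [toF, Derivation.leibniz, smul_eq_mul, map_add, map_mul]
  ring

/-- The linear form `∑_j e_{ij} s_j`. -/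
def linS (n r : ℕ) (e : Fin n → Fin r → ℕ) (i : Fin n) : XS ℂ n r :=
  ∑ j, C (e i j : ℂ) * X (Sum.inr j)

lemma X_mul_pderiv_monomial (n : ℕ) (d : Fin n → ℕ) (i : Fin n) :
    X i * pderiv i (∏ l, (X l : MvPolynomial (Fin n) ℂ) ^ d l) =
      C (d i : ℂ) * ∏ l, X l ^ d l := by
  have h0 : pderiv i (∏ l ∈ Finset.univ.erase i, (X l : MvPolynomial (Fin n) ℂ) ^ d l) = 0 := by
    refine Finset.prod_induction _ (fun p => pderiv i p = 0) ?_ (by simp) ?_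
    · intro p q hp hq
      simp [Derivation.leibniz, hp, hq]
    · intro l hl
      simp [Derivation.leibniz_pow, pderiv_X_of_ne (Finset.ne_of_mem_erase hl)]
  rw [← Finset.mul_prod_erase _ _ (Finset.mem_univ i), Derivation.leibniz, h0,
    Derivation.leibniz_pow, pderiv_X_self]
  rcases d i with _ | t
  · simp
  · simp only [smul_eq_mul, nsmul_eq_mul, Nat.add_sub_cancel, map_natCast]
    ring

lemma X_mul_twist (n r : ℕ) (e : Fin n → Fin r → ℕ) (i : Fin n) :
    toF ℂ n r (X (Sum.inl i)) * twist ℂ n r (fun j => ∏ l, X l ^ e l j) i =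
      toF ℂ n r (linS n r e i) := by
  have hX (j : Fin r) : toF ℂ n r (px ℂ n r (∏ l, X l ^ e l j)) ≠ 0 := by
    simp [toF, px, Finset.prod_eq_zero_iff, X_ne_zero]
  have hstep (j : Fin r) :
      toF ℂ n r (X (Sum.inl i)) * toF ℂ n r (px ℂ n r (pderiv i (∏ l, X l ^ e l j))) =
        toF ℂ n r (C (e i j : ℂ)) * toF ℂ n r (px ℂ n r (∏ l, X l ^ e l j)) := by
    have := congrArg (fun p => toF ℂ n r (px ℂ n r p))
      (X_mul_pderiv_monomial n (fun l => e l j) i)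
    simpa only [toF, px, map_mul, rename_X, rename_C] using this
  have hsum : toF ℂ n r (linS n r e i) =
      ∑ j, toF ℂ n r (C (e i j : ℂ)) * toF ℂ n r (X (Sum.inr j)) := by
    simp only [toF, linS, map_sum, map_mul]
  rw [twist, Finset.mul_sum, hsum]
  refine Finset.sum_congr rfl fun j _ => ?_
  rw [← mul_div_assoc, div_eq_iff (hX j)]
  linear_combination toF ℂ n r (X (Sum.inr j)) * hstep j

lemma pderiv_linS (n r : ℕ) (e : Fin n → Fin r → ℕ) (i l : Fin n) :
    pderiv (Sum.inl i) (linS n r e l) = 0 := by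
  simp [linS, Derivation.leibniz]

/-- One twisted derivative lowers the exponent of `x_i` by one. -/
lemma nabla_mul_X_pow_succ (n r : ℕ) (e : Fin n → Fin r → ℕ) (i : Fin n) (w : XS ℂ n r)
    (hw : pderiv (Sum.inl i) w = 0) (t : ℕ) :
    nabla ℂ n r (fun j => ∏ l, X l ^ e l j) i (toF ℂ n r (w * X (Sum.inl i) ^ (t + 1))) =
      toF ℂ n r (w * (linS n r e i + C ((t + 1 : ℕ) : ℂ)) * X (Sum.inl i) ^ t) := by
  have htw := X_mul_twist n r e i
  rw [nabla, DX_toF, Derivation.leibniz, hw, Derivation.leibniz_pow, pderiv_X_self]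
  simp only [toF, smul_eq_mul, nsmul_eq_mul, Nat.add_sub_cancel, map_natCast, mul_zero, mul_one,
    add_zero, map_add, map_mul, map_pow, pow_succ] at htw ⊢
  linear_combination (algebraMap (XS ℂ n r) (Frac ℂ n r) w) *
    (algebraMap (XS ℂ n r) (Frac ℂ n r) (X (Sum.inl i))) ^ t * htw

/-- The factor `∏_{c=1}^{m} (∑_j e_{ij} s_j + k + c)`. -/
def shiftedFactor (n r : ℕ) (e : Fin n → Fin r → ℕ) (i : Fin n) (k m : ℕ) : XS ℂ n r :=
  ∏ c ∈ Finset.Icc 1 m, (linS n r e i + C (k : ℂ) + C (c : ℂ))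

lemma pderiv_shiftedFactor (n r : ℕ) (e : Fin n → Fin r → ℕ) (i l : Fin n) (k m : ℕ) :
    pderiv (Sum.inl i) (shiftedFactor n r e l k m) = 0 := by
  refine Finset.prod_induction _ (fun p => pderiv (Sum.inl i) p = 0) ?_ (by simp) ?_
  · intro p q hp hq
    simp [Derivation.leibniz, hp, hq]
  · intro c _
    simp only [map_add, pderiv_linS, pderiv_C, add_zero]

lemma shiftedFactor_succ (n r : ℕ) (e : Fin n → Fin r → ℕ) (i : Fin n) (k m : ℕ) :
    shiftedFactor n r e i k (m + 1) =
      shiftedFactor n r e i k m * (linS n r e i + C ((k + m + 1 : ℕ) : ℂ)) := by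
  rw [shiftedFactor, Finset.prod_Icc_succ_top (by omega), ← shiftedFactor, add_assoc (linS n r e i),
    ← C_add, ← Nat.cast_add, add_assoc k]

lemma nabla_iterate (n r : ℕ) (e : Fin n → Fin r → ℕ) (i : Fin n) (k m : ℕ) (w : XS ℂ n r)
    (hw : pderiv (Sum.inl i) w = 0) :
    (nabla ℂ n r (fun j => ∏ l, X l ^ e l j) i)^[m]
        (toF ℂ n r (w * X (Sum.inl i) ^ (k + m))) =
      toF ℂ n r (w * (shiftedFactor n r e i k m * X (Sum.inl i) ^ k)) := by
  induction m generalizing w with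
  | zero => simp [shiftedFactor]
  | succ m ih =>
    rw [Function.iterate_succ_apply, ← add_assoc, nabla_mul_X_pow_succ n r e i w hw, ih]
    · rw [shiftedFactor_succ]
      refine congrArg (toF ℂ n r) ?_
      ring
    · rw [Derivation.leibniz, hw, map_add, pderiv_linS, pderiv_C]
      simp

lemma foldr_nabla_iterate (n r : ℕ) (e : Fin n → Fin r → ℕ) (k m : Fin n → ℕ)
    (L : List (Fin n)) (hL : L.Nodup) (w : XS ℂ n r)
    (hw : ∀ i ∈ L, pderiv (Sum.inl i) w = 0) :
    (L.map fun i => (nabla ℂ n r (fun j => ∏ l, X l ^ e l j) i)^[m i]).foldr (· ∘ ·) id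
        (toF ℂ n r (w * (L.map fun i => X (Sum.inl i) ^ (k i + m i)).prod)) =
      toF ℂ n r (w *
        (L.map fun i => shiftedFactor n r e i (k i) (m i) * X (Sum.inl i) ^ k i).prod) := by
  induction L generalizing w with
  | nil => simp
  | cons i L ih =>
    rw [List.nodup_cons] at hL
    obtain ⟨hi, hL⟩ := hL
    simp only [List.map_cons, List.foldr_cons, List.prod_cons, Function.comp_apply]
    rw [← mul_assoc, ih hL, mul_right_comm, nabla_iterate]
    · congr 1
      ring
    · have hprod : pderiv (Sum.inl i) (L.map fun l =>
          shiftedFactor n r e l (k l) (m l) * X (Sum.inl l) ^ k l).prod = 0 := by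
        clear ih hw hL
        induction L with
        | nil => simp
        | cons l L ih =>
          rw [List.mem_cons, not_or] at hi
          have hne : (Sum.inl l : Fin n ⊕ Fin r) ≠ Sum.inl i := by
            simpa using Ne.symm hi.1
          rw [List.map_cons, List.prod_cons, Derivation.leibniz, ih hi.2, Derivation.leibniz,
            pderiv_shiftedFactor, Derivation.leibniz_pow, pderiv_X_of_ne hne]
          simp
      rw [Derivation.leibniz, hprod, hw i List.mem_cons_self]
      simp
    · intro l hl
      have hne : (Sum.inl i : Fin n ⊕ Fin r) ≠ Sum.inl l := by
        rintro h
        exact hi (Sum.inl_injective h ▸ hl)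
      rw [Derivation.leibniz, hw l (List.mem_cons_of_mem _ hl), Derivation.leibniz_pow,
        pderiv_X_of_ne hne]
      simp

lemma iterNabla_mem (n r : ℕ) (f : Fin r → MvPolynomial (Fin n) ℂ) (m : Fin n → ℕ)
    (N : Submodule (XS ℂ n r) (Frac ℂ n r)) (hN : ∀ i, ∀ x ∈ N, nabla ℂ n r f i x ∈ N)
    (x : Frac ℂ n r) (hx : x ∈ N) : iterNabla n r f m x ∈ N := by
  rw [iterNabla, List.ofFn_eq_map]
  induction List.finRange n with
  | nil => simpa using hx
  | cons i L ih =>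
    exact Set.MapsTo.iterate (s := (N : Set (Frac ℂ n r))) (fun y hy => hN i y hy) (m i) ih

/-- `x^k F^{s+a}` is the monomial with exponents `k_i + m_i`. -/
lemma px_monomial_mul_prod (n r : ℕ) (e : Fin n → Fin r → ℕ) (k : Fin n → ℕ) (a : Fin r → ℕ)
    (m : Fin n → ℕ) (hm : ∀ i, m i = ∑ j, a j * e i j) :
    px ℂ n r (∏ i, X i ^ k i) * ∏ j, px ℂ n r (∏ i, X i ^ e i j) ^ a j =
      ∏ i, X (Sum.inl i) ^ (k i + m i) := by
  simp only [px, map_prod, map_pow, rename_X, ← Finset.prod_pow, ← pow_mul]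
  rw [Finset.prod_comm, ← Finset.prod_mul_distrib]
  refine Finset.prod_congr rfl fun i _ => ?_
  rw [Finset.prod_pow_eq_pow_sum, pow_add, hm]
  simp only [mul_comm]

lemma ps_prod_factor (n r : ℕ) (e : Fin n → Fin r → ℕ) (k m : Fin n → ℕ) :
    ps ℂ n r (∏ i, ∏ c ∈ Finset.Icc 1 (m i),
        ((∑ j, C ((e i j : ℂ)) * X j) + C ((k i : ℂ)) + C ((c : ℂ)))) =
      ∏ i, shiftedFactor n r e i (k i) (m i) := by
  simp only [ps, shiftedFactor, linS, map_prod, map_add, map_sum, map_mul, rename_X, rename_C]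

/-- Monomial functional equation with a twist: for `f_j = ∏ᵢ xᵢ^{e_{ij}}`, `k ∈ ℕⁿ`, `a ∈ ℕ^r`
and `mᵢ = ∑_j a_j e_{ij}`, one has
`(∇₁^{m₁} ∘ ⋯ ∘ ∇ₙ^{mₙ})(x^k·F^{s+a}) = q(s)·x^k·F^s` where
`q(s) = ∏ᵢ ∏_{c=1}^{mᵢ} (∑_j e_{ij}s_j + kᵢ + c)`; in particular `q(s)·x^k·F^s` lies in the
smallest `ℂ[x,s]`-submodule containing `x^k·F^{s+a}` and stable under `∇₁,…,∇ₙ`. -/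
theorem stmt3 (n r : ℕ) (hn : 1 ≤ n) (hr : 1 ≤ r)
    (e : Fin n → Fin r → ℕ)
    (hf : ∀ c0 : ℂ, (∏ j, ∏ i, (X i : MvPolynomial (Fin n) ℂ) ^ e i j) ≠ C c0)
    (k : Fin n → ℕ) (a : Fin r → ℕ) (m : Fin n → ℕ) (hm : ∀ i, m i = ∑ j, a j * e i j) :
    iterNabla n r (fun j => ∏ i, X i ^ e i j) m
        (toF ℂ n r (px ℂ n r (∏ i, X i ^ k i) *
          ∏ j, px ℂ n r (∏ i, X i ^ e i j) ^ a j)) =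
      toF ℂ n r (ps ℂ n r (∏ i, ∏ c ∈ Finset.Icc 1 (m i),
          ((∑ j, C ((e i j : ℂ)) * X j) + C ((k i : ℂ)) + C ((c : ℂ))))) *
        toF ℂ n r (px ℂ n r (∏ i, X i ^ k i)) ∧
    toF ℂ n r (ps ℂ n r (∏ i, ∏ c ∈ Finset.Icc 1 (m i),
          ((∑ j, C ((e i j : ℂ)) * X j) + C ((k i : ℂ)) + C ((c : ℂ))))) *
        toF ℂ n r (px ℂ n r (∏ i, X i ^ k i)) ∈
      sInf {Nsub : Submodule (XS ℂ n r) (Frac ℂ n r) |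
        toF ℂ n r (px ℂ n r (∏ i, X i ^ k i) *
          ∏ j, px ℂ n r (∏ i, X i ^ e i j) ^ a j) ∈ Nsub ∧
        ∀ i : Fin n, ∀ x ∈ Nsub, nabla ℂ n r (fun j => ∏ i, X i ^ e i j) i x ∈ Nsub} := by
  have key : iterNabla n r (fun j => ∏ i, X i ^ e i j) m
        (toF ℂ n r (px ℂ n r (∏ i, X i ^ k i) *
          ∏ j, px ℂ n r (∏ i, X i ^ e i j) ^ a j)) =
      toF ℂ n r (ps ℂ n r (∏ i, ∏ c ∈ Finset.Icc 1 (m i),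
          ((∑ j, C ((e i j : ℂ)) * X j) + C ((k i : ℂ)) + C ((c : ℂ))))) *
        toF ℂ n r (px ℂ n r (∏ i, X i ^ k i)) := by
    have h := foldr_nabla_iterate n r e k m (List.finRange n) (List.nodup_finRange n) 1
      (by simp)
    simp only [← List.ofFn_eq_map, List.prod_ofFn, one_mul] at h
    rw [px_monomial_mul_prod n r e k a m hm, ps_prod_factor, iterNabla, h,
      Finset.prod_mul_distrib]
    simp only [toF, px, map_mul, map_prod, map_pow, rename_X]
  refine ⟨key, Submodule.mem_sInf.mpr fun N hN => ?_⟩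
  rw [← key]
  exact iterNabla_mem n r _ m N hN.2 _ hN.1

end
end

section
/- Real LCT-polytope roots (analytic form, generalizing Saito's theorem that the negative of the real log-canonical threshold is a root of the Bernstein–Sato polynomial): let f_1,…,f_r ∈ ℝ[x_1,…,x_n] and assume a_j ≥ 1 for all j = 1,…,r. Let λ ∈ ℝ_{≥0}^r and x₀ ∈ ℝⁿ and assume: (i) for every ε = (ε_1,…,ε_r) ∈ ℝ_{>0}^r the function ∏_{j=1}^r |f_j|^{−(λ_j−ε_j)} is integrable near x₀; (ii) ∏_{j=1}^r |f_j|^{−λ_j} is not integrable near x₀. Then every b in the real Bernstein–Sato ideal B_{F,ℝ}^a satisfies b(−λ_1,…,−λ_r) = 0. -/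
open MvPolynomial MeasureTheory

noncomputable section

/-- A nonnegative function on `ℝⁿ` is integrable near `x₀` if it is integrable on an open
neighbourhood of `x₀` (for the Lebesgue measure). -/
def IntegrableNearR (n : ℕ) (h : (Fin n → ℝ) → ℝ) (x₀ : Fin n → ℝ) : Prop :=
  ∃ U : Set (Fin n → ℝ), IsOpen U ∧ x₀ ∈ U ∧ IntegrableOn h U

section

open Filter Topology ProbabilityTheory

lemma MvPolynomial.volume_zeros_eq_zero {n : ℕ} {p : MvPolynomial (Fin n) ℝ} (hp : p ≠ 0) :
    volume {x : Fin n → ℝ | eval x p = 0} = 0 := by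
  obtain ⟨y, hy⟩ : ∃ y, eval y p ≠ 0 := by
    by_contra! h
    exact hp (MvPolynomial.funext fun x => by simp [h x])
  have hcont : Continuous fun z : ℝ × (Fin n → ℝ) => eval (y + z.1 • z.2) p :=
    (MvPolynomial.continuous_eval p).comp (by fun_prop)
  have hline (x : Fin n → ℝ) : volume {t : ℝ | eval (y + t • x) p = 0} = 0 := by
    set q : Polynomial ℝ :=
      aeval (fun i => Polynomial.C (y i) + Polynomial.X * Polynomial.C (x i)) p with hq
    have hqe (t : ℝ) : q.eval t = eval (y + t • x) p := by
      rw [hq, ← Polynomial.coe_evalRingHom, ← MvPolynomial.coe_aeval_eq_eval,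
        MvPolynomial.aeval_def, MvPolynomial.hom_eval₂]
      simp only [RingHom.coe_coe, MvPolynomial.aeval_def]
      congr 1
      · ext; simp
      · ext; simp; ring
    have hq0 : q ≠ 0 := by
      intro h
      have := hqe 0
      simp [h] at this
      exact hy this.symm
    refine Set.Finite.measure_zero ?_ _
    refine (q.rootSet_finite ℝ).subset fun t ht => ?_
    rw [Polynomial.mem_rootSet]
    exact ⟨hq0, by simpa [hqe] using ht⟩
  have hprod : (volume.prod volume : Measure ((Fin n → ℝ) × ℝ))
      {z | eval (y + z.2 • z.1) p = 0} = 0 := by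
    have hmeas : MeasurableSet {z : (Fin n → ℝ) × ℝ | eval (y + z.2 • z.1) p = 0} :=
      (isClosed_singleton.preimage (hcont.comp continuous_swap)).measurableSet
    rw [Measure.measure_prod_null hmeas]
    exact ae_of_all _ hline
  have hprod' : (volume.prod volume : Measure (ℝ × (Fin n → ℝ)))
      {z | eval (y + z.1 • z.2) p = 0} = 0 := by
    have hmeas : MeasurableSet {z : ℝ × (Fin n → ℝ) | eval (y + z.1 • z.2) p = 0} :=
      (isClosed_singleton.preimage hcont).measurableSet
    rw [← Measure.prod_swap, Measure.map_apply measurable_swap hmeas]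
    exact hprod
  have hae := Measure.measure_ae_null_of_prod_null hprod'
  obtain ⟨t, ht, ht0⟩ := (hae.and (Measure.ae_ne volume (0 : ℝ))).exists
  have h1 : volume ((t • ·) ⁻¹' ((y + ·) ⁻¹' {x : Fin n → ℝ | eval x p = 0})) = 0 := ht
  rw [Measure.addHaar_preimage_smul _ ht0, measure_preimage_add] at h1
  refine (mul_eq_zero.mp h1).resolve_left ?_
  simpa using pow_pos (abs_pos.mpr ht0) n

lemma MvPolynomial.hasDerivAt_eval_comp {σ : Type*} [DecidableEq σ] (i : σ) (c : ℝ → σ → ℝ) (t : ℝ)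
    (hc : ∀ j, HasDerivAt (fun u => c u j) (if j = i then 1 else 0) t)
    (p : MvPolynomial σ ℝ) :
    HasDerivAt (fun u => eval (c u) p) (eval (c t) (pderiv i p)) t := by
  induction p using MvPolynomial.induction_on with
  | C a => simpa using hasDerivAt_const t a
  | add p q hp hq => simpa using! hp.add hq
  | mul_X p j hp =>
    have := hp.mul (hc j)
    simp only [map_mul, eval_X, Derivation.leibniz, smul_eq_mul, pderiv_X, map_add]
    convert! this using 1
    by_cases h : j = i
    · subst h; simp; ring
    · simp [h]; ring

/-- A nonnegative measure's moment generating function which continues holomorphically to a disc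
centred at a point of its domain of convergence converges on the real points of that disc. -/
lemma integrable_exp_of_complexMGF_continuation {Ω : Type*} [MeasurableSpace Ω] {μ : Measure Ω}
    {X : Ω → ℝ} {c R r : ℝ} {G : ℂ → ℂ} (hG : DifferentiableOn ℂ G (Metric.ball (c : ℂ) R))
    (hc : c ∈ interior (integrableExpSet X μ)) (heq : G =ᶠ[𝓝 (c : ℂ)] complexMGF X μ)
    (hr0 : 0 ≤ r) (hrR : r < R) : Integrable (fun ω => Real.exp ((c - r) * X ω)) μ := by
  have hX : AEMeasurable X μ := aemeasurable_of_mem_interior_integrableExpSet hc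
  have hcoef (k : ℕ) : iteratedDeriv k G c = ((∫ ω, X ω ^ k * Real.exp (c * X ω) ∂μ : ℝ) : ℂ) := by
    rw [heq.iteratedDeriv_eq k, iteratedDeriv_complexMGF (by simpa using hc), ← integral_complex_ofReal]
    simp
  have hsum (s : ℝ) (hs : |s| < R) : Summable fun k : ℕ =>
      (k.factorial : ℝ)⁻¹ * s ^ k * ∫ ω, X ω ^ k * Real.exp (c * X ω) ∂μ := by
    have := (Complex.hasSum_taylorSeries_on_ball hG (z := c + s) (by simpa using hs)).summable
    rw [← Complex.summable_ofReal]
    refine this.congr fun k => ?_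
    rw [hcoef]
    simp [mul_assoc]
  set F : ℕ → Ω → ℝ := fun k ω =>
    ((k.factorial : ℝ)⁻¹ * r ^ k + (k.factorial : ℝ)⁻¹ * (-r) ^ k) *
      (X ω ^ k * Real.exp (c * X ω)) with hF
  have hint (k : ℕ) : Integrable (fun ω => X ω ^ k * Real.exp (c * X ω)) μ :=
    integrable_pow_mul_exp_of_mem_interior_integrableExpSet hc k
  have hFint (k : ℕ) : Integrable (F k) μ := (hint k).const_mul _
  have hFnn (k : ℕ) (ω : Ω) : 0 ≤ F k ω := by
    rcases Nat.even_or_odd k with hk | hk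
    · simp only [hF, hk.neg_pow]
      have := hk.pow_nonneg (X ω)
      positivity
    · simp [hF, hk.neg_pow]
  have hFsum : Summable fun k => ∫ ω, F k ω ∂μ := by
    simp only [hF, integral_const_mul]
    simp only [add_mul]
    exact (hsum r (by rwa [abs_of_nonneg hr0])).add (hsum (-r) (by rwa [abs_neg, abs_of_nonneg hr0]))
  have hpt (ω : Ω) : HasSum (fun k => F k ω)
      (Real.exp ((c + r) * X ω) + Real.exp ((c - r) * X ω)) := by
    have h (s : ℝ) : HasSum (fun k : ℕ => (k.factorial : ℝ)⁻¹ * s ^ k *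
        (X ω ^ k * Real.exp (c * X ω))) (Real.exp ((c + s) * X ω)) := by
      have := (NormedSpace.expSeries_div_hasSum_exp (s * X ω)).mul_right
        (Real.exp (c * X ω))
      rw [← Real.exp_eq_exp_ℝ, ← Real.exp_add] at this
      convert! this using 1
      · ext k; rw [mul_pow]; ring
      · congr 1; ring
    convert! (h r).add (h (-r)) using 1
    ext k; simp only [hF]; ring
  have htot : Integrable (fun ω => Real.exp ((c + r) * X ω) + Real.exp ((c - r) * X ω)) μ := by
    refine ⟨by fun_prop, ?_⟩
    rw [hasFiniteIntegral_iff_ofReal (ae_of_all _ fun ω => by positivity)]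
    calc ∫⁻ ω, ENNReal.ofReal (Real.exp ((c + r) * X ω) + Real.exp ((c - r) * X ω)) ∂μ
        = ∫⁻ ω, ∑' k, ENNReal.ofReal (F k ω) ∂μ := by
          refine lintegral_congr fun ω => ?_
          rw [← (hpt ω).tsum_eq, ENNReal.ofReal_tsum_of_nonneg (fun k => hFnn k ω) (hpt ω).summable]
      _ = ∑' k, ∫⁻ ω, ENNReal.ofReal (F k ω) ∂μ :=
          lintegral_tsum fun k => (hFint k).aestronglyMeasurable.aemeasurable.ennreal_ofReal
      _ = ∑' k, ENNReal.ofReal (∫ ω, F k ω ∂μ) := by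
          congr 1; ext k
          rw [ofReal_integral_eq_lintegral_ofReal (hFint k) (ae_of_all _ (hFnn k))]
      _ < ⊤ := hFsum.tsum_ofReal_lt_top
  refine htot.mono' (by fun_prop) (ae_of_all _ fun ω => ?_)
  rw [Real.norm_of_nonneg (by positivity)]
  linarith [Real.exp_pos ((c + r) * X ω)]

lemma toF_injective (K0 : Type) [Field K0] (n r : ℕ) : Function.Injective (toF K0 n r) :=
  IsFractionRing.injective (XS K0 n r) (Frac K0 n r)

lemma toF_ne_zero {K0 : Type} [Field K0] {n r : ℕ} {p : XS K0 n r} (hp : p ≠ 0) :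
    toF K0 n r p ≠ 0 := fun h => hp (toF_injective K0 n r (by rw [h]; simp [toF]))

lemma DX_toF_div_toF {K0 : Type} [Field K0] {n r : ℕ} (i : Fin n) (p : XS K0 n r) {q : XS K0 n r}
    (hq : q ≠ 0) :
    DX K0 n r i (toF K0 n r p / toF K0 n r q) =
      (toF K0 n r (pderiv (Sum.inl i) p) * toF K0 n r q -
        toF K0 n r p * toF K0 n r (pderiv (Sum.inl i) q)) / toF K0 n r q ^ 2 := by
  have h := IsFractionRing.div_surjective (A := XS K0 n r) (toF K0 n r p / toF K0 n r q)
  have key (p' q' : XS K0 n r) (hq' : q' ≠ 0)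
      (e : toF K0 n r p' / toF K0 n r q' = toF K0 n r p / toF K0 n r q) :
      (toF K0 n r (pderiv (Sum.inl i) p') * toF K0 n r q' -
        toF K0 n r p' * toF K0 n r (pderiv (Sum.inl i) q')) / toF K0 n r q' ^ 2 =
      (toF K0 n r (pderiv (Sum.inl i) p) * toF K0 n r q -
        toF K0 n r p * toF K0 n r (pderiv (Sum.inl i) q)) / toF K0 n r q ^ 2 := by
    have hQ := toF_ne_zero hq
    have hQ' := toF_ne_zero hq'
    rw [div_eq_div_iff hQ' hQ] at e
    have e0 : p' * q = p * q' := toF_injective K0 n r (by simpa [toF] using e)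
    have e1 := congrArg (fun z => toF K0 n r (pderiv (Sum.inl i) z)) e0
    simp only [Derivation.leibniz, smul_eq_mul, toF, map_add, map_mul] at e1 e hQ hQ' ⊢
    rw [div_eq_div_iff (pow_ne_zero 2 hQ') (pow_ne_zero 2 hQ)]
    linear_combination (algebraMap (XS K0 n r) (Frac K0 n r) q) *
      (algebraMap (XS K0 n r) (Frac K0 n r) q') * e1 -
      ((algebraMap (XS K0 n r) (Frac K0 n r) q) *
        (algebraMap (XS K0 n r) (Frac K0 n r) (pderiv (Sum.inl i) q')) +
      (algebraMap (XS K0 n r) (Frac K0 n r) q') *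
        (algebraMap (XS K0 n r) (Frac K0 n r) (pderiv (Sum.inl i) q))) * e
  exact key h.choose h.choose_spec.choose (nonZeroDivisors.ne_zero h.choose_spec.choose_spec.1)
    h.choose_spec.choose_spec.2

/-- The product `f_1⋯f_r` in `K0[x,s]`. -/
def pxProd {K0 : Type} [Field K0] {n r : ℕ} (f : Fin r → MvPolynomial (Fin n) K0) : XS K0 n r :=
  ∏ j, px K0 n r (f j)

/-- The numerator over `(f_1⋯f_r)^(k+1)` of `∇_i` applied to `G / (f_1⋯f_r)^k`. -/
def nablaNum {K0 : Type} [Field K0] {n r : ℕ} (f : Fin r → MvPolynomial (Fin n) K0) (i : Fin n)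
    (k : ℕ) (G : XS K0 n r) : XS K0 n r :=
  pderiv (Sum.inl i) G * pxProd f +
    G * ∑ j, (X (Sum.inr j) - C (k : K0)) * px K0 n r (pderiv i (f j)) *
      ∏ l ∈ Finset.univ.erase j, px K0 n r (f l)

lemma pxProd_ne_zero {K0 : Type} [Field K0] {n r : ℕ} {f : Fin r → MvPolynomial (Fin n) K0}
    (hf : ∀ j, f j ≠ 0) : pxProd f ≠ 0 :=
  Finset.prod_ne_zero_iff.mpr fun j _ h =>
    hf j (rename_injective _ Sum.inl_injective (by simpa [px] using h))

lemma MvPolynomial.pderiv_prod {σ ι R : Type*} [CommSemiring R] [DecidableEq ι] (i : σ)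
    (s : Finset ι) (g : ι → MvPolynomial σ R) :
    pderiv i (∏ j ∈ s, g j) = ∑ j ∈ s, pderiv i (g j) * ∏ l ∈ s.erase j, g l := by
  induction s using Finset.induction_on with
  | empty => simp
  | insert a s ha ih =>
    rw [Finset.prod_insert ha, Derivation.leibniz, ih, Finset.sum_insert ha,
      Finset.erase_insert ha, smul_eq_mul, smul_eq_mul, add_comm, Finset.mul_sum]
    congr 1
    · ring
    · refine Finset.sum_congr rfl fun j hj => ?_
      rw [Finset.erase_insert_of_ne (fun h : a = j => ha (h ▸ hj)),
        Finset.prod_insert (fun h => ha (Finset.mem_of_mem_erase h))]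
      ring

lemma pderiv_pxProd {K0 : Type} [Field K0] {n r : ℕ} (f : Fin r → MvPolynomial (Fin n) K0)
    (i : Fin n) : pderiv (Sum.inl i) (pxProd f) =
      ∑ j, px K0 n r (pderiv i (f j)) * ∏ l ∈ Finset.univ.erase j, px K0 n r (f l) := by
  rw [pxProd, pderiv_prod]
  refine Finset.sum_congr rfl fun j _ => ?_
  rw [px, px, pderiv_rename Sum.inl_injective]

lemma twist_mul_pxProd {K0 : Type} [Field K0] {n r : ℕ} {f : Fin r → MvPolynomial (Fin n) K0}
    (hf : ∀ j, f j ≠ 0) (i : Fin n) : twist K0 n r f i * toF K0 n r (pxProd f) =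
      toF K0 n r (∑ j, X (Sum.inr j) * px K0 n r (pderiv i (f j)) *
        ∏ l ∈ Finset.univ.erase j, px K0 n r (f l)) := by
  rw [twist, Finset.sum_mul]
  simp only [toF, map_sum]
  refine Finset.sum_congr rfl fun j _ => ?_
  have hj : algebraMap (XS K0 n r) (Frac K0 n r) (px K0 n r (f j)) ≠ 0 :=
    toF_ne_zero fun h => hf j (rename_injective _ Sum.inl_injective (by simpa [px] using h))
  rw [pxProd, ← Finset.mul_prod_erase _ _ (Finset.mem_univ j)]
  simp only [map_mul]
  field_simp

lemma nabla_mul_pxProd_pow {K0 : Type} [Field K0] {n r : ℕ} {f : Fin r → MvPolynomial (Fin n) K0}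
    (hf : ∀ j, f j ≠ 0) (i : Fin n) {k : ℕ} {g : Frac K0 n r} {G : XS K0 n r}
    (hg : g * toF K0 n r (pxProd f) ^ k = toF K0 n r G) :
    nabla K0 n r f i g * toF K0 n r (pxProd f) ^ (k + 1) = toF K0 n r (nablaNum f i k G) := by
  have hP := pxProd_ne_zero hf
  have hP' := toF_ne_zero hP
  have hg' : g = toF K0 n r G / toF K0 n r (pxProd f ^ k) := by
    rw [eq_div_iff (toF_ne_zero (pow_ne_zero k hP)), ← hg]; simp [toF]
  have ht := twist_mul_pxProd hf i
  have hnum : nablaNum f i k G = pderiv (Sum.inl i) G * pxProd f +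
      G * (∑ j, X (Sum.inr j) * px K0 n r (pderiv i (f j)) *
        ∏ l ∈ Finset.univ.erase j, px K0 n r (f l)) -
      G * C (k : K0) * pderiv (Sum.inl i) (pxProd f) := by
    rw [pderiv_pxProd, nablaNum, mul_assoc, Finset.mul_sum (a := C (k : K0)), add_sub_assoc,
      ← mul_sub, ← Finset.sum_sub_distrib]
    congr 2
    refine Finset.sum_congr rfl fun j _ => by ring
  rw [nabla, hg', DX_toF_div_toF i G (pow_ne_zero k hP), add_mul, hnum]
  simp only [toF, map_add, map_sub, map_mul] at ht hP' ⊢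
  rw [← ht]
  simp only [Derivation.leibniz_pow, map_pow, smul_eq_mul, nsmul_eq_mul, map_mul, map_natCast]
  rcases k with _ | k
  · simp; ring
  · simp only [Nat.add_sub_cancel]
    field_simp
    ring

/-- The function `|y|^s / y^k`. -/
def regPow (s : ℝ) (k : ℕ) (y : ℝ) : ℝ := |y| ^ s * (y ^ k)⁻¹

lemma regPow_eq_mul {s : ℝ} (hs : s ≠ 0) (k : ℕ) (y : ℝ) :
    regPow s k y = y * regPow s (k + 1) y := by
  rcases eq_or_ne y 0 with rfl | hy
  · simp [regPow, Real.zero_rpow hs]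
  · simp only [regPow]; field_simp; ring

lemma abs_regPow {s : ℝ} {k : ℕ} (hs : k < s) (y : ℝ) : |regPow s k y| = |y| ^ (s - k) := by
  rcases eq_or_ne y 0 with rfl | hy
  · have : s ≠ 0 := by have : (0 : ℝ) ≤ k := k.cast_nonneg; linarith
    simp [regPow, Real.zero_rpow this, Real.zero_rpow (sub_ne_zero.mpr hs.ne')]
  · rw [regPow, Real.rpow_sub (abs_pos.mpr hy), Real.rpow_natCast, abs_mul, abs_inv, abs_pow,
      abs_of_nonneg (by positivity : 0 ≤ |y| ^ s), div_eq_mul_inv]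

lemma hasDerivAt_regPow {s : ℝ} {k : ℕ} (hs : k + 1 < s) (y : ℝ) :
    HasDerivAt (regPow s k) ((s - k) * regPow s (k + 1) y) y := by
  have hk : (0 : ℝ) ≤ k := k.cast_nonneg
  rcases eq_or_ne y 0 with rfl | hy
  · have hs0 : s ≠ 0 := by linarith
    have h0 : HasDerivAt (fun y : ℝ => |y| ^ (s - k)) 0 0 := by
      simpa using hasDerivAt_abs_rpow 0 (p := s - k) (by linarith)
    rw [hasDerivAt_iff_isLittleO] at h0 ⊢
    have hz (m : ℕ) : regPow s m 0 = 0 := by simp [regPow, Real.zero_rpow hs0]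
    simp only [abs_zero, Real.zero_rpow (show s - k ≠ 0 by linarith), sub_zero, smul_zero,
      hz, mul_zero] at h0 ⊢
    refine Asymptotics.IsBigO.trans_isLittleO ?_ h0
    refine Asymptotics.IsBigO.of_bound 1 (Eventually.of_forall fun y => ?_)
    rw [Real.norm_eq_abs, abs_regPow (by linarith), one_mul, Real.norm_eq_abs]
    exact le_abs_self _
  · have h1 := hasDerivAt_abs_rpow y (p := s) (by linarith)
    have h2 := (hasDerivAt_pow k y).inv (pow_ne_zero k hy)
    convert! h1.mul h2 using 1
    have hpow : |y| ^ (s - 2) = |y| ^ s / y ^ 2 := by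
      rw [Real.rpow_sub (abs_pos.mpr hy), Real.rpow_two, sq_abs]
    rw [hpow, regPow]
    rcases k with _ | k
    · simp; field_simp
    · simp only [Nat.add_sub_cancel]
      push_cast
      simp only [Pi.inv_apply]
      field_simp
      ring

lemma continuous_regPow {s : ℝ} {k : ℕ} (hs : k + 1 < s) : Continuous (regPow s k) :=
  continuous_iff_continuousAt.mpr fun y => (hasDerivAt_regPow hs y).continuousAt

/-- The function of `x` obtained from `G / (f_1⋯f_r)^k · F^s` by replacing each `f_j^{s_j}` with
`|f_j|^{s_j}`. -/
def twistedVal {n r : ℕ} (f : Fin r → MvPolynomial (Fin n) ℝ) (s : Fin r → ℝ) (k : ℕ)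
    (G : XS ℝ n r) (x : Fin n → ℝ) : ℝ :=
  eval (Sum.elim x s) G * ∏ j, regPow (s j) k (eval x (f j))

section TwistedVal

variable {n r : ℕ} {f : Fin r → MvPolynomial (Fin n) ℝ} {s : Fin r → ℝ} {k : ℕ}

lemma eval_px (x : Fin n → ℝ) (s : Fin r → ℝ) (p : MvPolynomial (Fin n) ℝ) :
    eval (Sum.elim x s) (px ℝ n r p) = eval x p := by
  rw [px, eval_rename]; rfl

lemma eval_ps (x : Fin n → ℝ) (s : Fin r → ℝ) (p : MvPolynomial (Fin r) ℝ) :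
    eval (Sum.elim x s) (ps ℝ n r p) = eval s p := by
  rw [ps, eval_rename]; rfl

lemma twistedVal_mul_pxProd (hs : ∀ j, s j ≠ 0) (G : XS ℝ n r) (x : Fin n → ℝ) :
    twistedVal f s (k + 1) (G * pxProd f) x = twistedVal f s k G x := by
  simp only [twistedVal, pxProd, map_mul, map_prod, eval_px, regPow_eq_mul (hs _) k]
  rw [Finset.prod_mul_distrib, mul_assoc]

lemma twistedVal_mul_pxProd_pow (hs : ∀ j, s j ≠ 0) (G : XS ℝ n r) (m : ℕ) (x : Fin n → ℝ) :
    twistedVal f s (k + m) (G * pxProd f ^ m) x = twistedVal f s k G x := by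
  induction m with
  | zero => simp
  | succ m ih => rw [pow_succ, ← mul_assoc, ← add_assoc, twistedVal_mul_pxProd hs, ih]

lemma continuous_eval_sumElim (s : Fin r → ℝ) (G : XS ℝ n r) :
    Continuous fun x : Fin n → ℝ => eval (Sum.elim x s) G :=
  (MvPolynomial.continuous_eval G).comp <| continuous_pi fun j => by
    cases j
    · exact continuous_apply _
    · exact continuous_const

lemma continuous_twistedVal (hs : ∀ j, k + 1 < s j) (G : XS ℝ n r) :
    Continuous (twistedVal f s k G) :=
  (continuous_eval_sumElim s G).mul <| continuous_finsetProd _ fun j _ =>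
    (continuous_regPow (hs j)).comp (MvPolynomial.continuous_eval _)

lemma hasLineDerivAt_twistedVal (hs : ∀ j, k + 1 < s j) (G : XS ℝ n r) (i : Fin n)
    (x : Fin n → ℝ) :
    HasLineDerivAt ℝ (twistedVal f s k G) (twistedVal f s (k + 1) (nablaNum f i k G) x) x
      (Pi.single i 1) := by
  have hs0 (j) : s j ≠ 0 := by
    have := hs j
    have : (0 : ℝ) ≤ k := k.cast_nonneg
    linarith
  have hx (l : Fin n) : HasDerivAt (fun u : ℝ => (x + u • (Pi.single i 1 : Fin n → ℝ)) l)
      (if l = i then 1 else 0) 0 := by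
    have := ((hasDerivAt_id (0 : ℝ)).mul_const ((Pi.single i 1 : Fin n → ℝ) l)).const_add (x l)
    simpa [Pi.single_apply] using! this
  have hfj (j : Fin r) : HasDerivAt
      (fun u : ℝ => regPow (s j) k (eval (x + u • (Pi.single i 1 : Fin n → ℝ)) (f j)))
      ((s j - k) * regPow (s j) (k + 1) (eval x (f j)) * eval x (pderiv i (f j))) 0 := by
    have h1 := hasDerivAt_eval_comp i _ 0 hx (f j)
    have h2 := hasDerivAt_regPow (hs j) (eval (x + (0 : ℝ) • (Pi.single i 1 : Fin n → ℝ)) (f j))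
    simpa using! h2.comp (0 : ℝ) h1
  have hG : HasDerivAt
      (fun u : ℝ => eval (Sum.elim (x + u • (Pi.single i 1 : Fin n → ℝ)) s) G)
      (eval (Sum.elim x s) (pderiv (Sum.inl i) G)) 0 := by
    have := hasDerivAt_eval_comp (Sum.inl i : Fin n ⊕ Fin r)
      (fun u : ℝ => Sum.elim (x + u • (Pi.single i 1 : Fin n → ℝ)) s) 0 (fun j => by
        rcases j with j | j
        · simpa using hx j
        · simpa using hasDerivAt_const (0 : ℝ) (s j)) G
    simpa using this
  have hprod := HasDerivAt.fun_finsetProd (u := Finset.univ) fun j _ => hfj j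
  have := hG.mul hprod
  unfold HasLineDerivAt
  convert! this using 1
  simp only [zero_smul, add_zero, twistedVal, nablaNum, pxProd, map_add, map_mul, map_prod,
    map_sum, map_sub, eval_px, eval_X, eval_C, Sum.elim_inr, smul_eq_mul]
  rw [add_mul, mul_assoc, mul_assoc, ← Finset.prod_mul_distrib, Finset.sum_mul]
  congr 1
  · simp only [← regPow_eq_mul (hs0 _)]
  · congr 1
    refine Finset.sum_congr rfl fun j _ => ?_
    rw [← Finset.mul_prod_erase _ (fun l => regPow (s l) (k + 1) (eval x (f l)))
      (Finset.mem_univ j), Finset.prod_congr rfl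
        (fun l _ => regPow_eq_mul (hs0 l) k (eval x (f l))), Finset.prod_mul_distrib]
    ring
end TwistedVal

/-- `J` agrees near `+∞` with a function holomorphic on `S`. -/
def HasContinuation (S : Set ℂ) (J : ℝ → ℝ) : Prop :=
  ∃ H : ℂ → ℂ, DifferentiableOn ℂ H S ∧ ∀ᶠ t : ℝ in atTop, (J t : ℂ) = H t

namespace HasContinuation

variable {S : Set ℂ} {J K : ℝ → ℝ}

lemma congr (h : HasContinuation S J) (e : J =ᶠ[atTop] K) : HasContinuation S K := by
  obtain ⟨H, hH, hJ⟩ := h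
  refine ⟨H, hH, ?_⟩
  filter_upwards [hJ, e] with t h1 h2
  rw [← h2, h1]

lemma add (hJ : HasContinuation S J) (hK : HasContinuation S K) :
    HasContinuation S (fun t => J t + K t) := by
  obtain ⟨H, hH, h1⟩ := hJ
  obtain ⟨L, hL, h2⟩ := hK
  refine ⟨fun z => H z + L z, hH.add hL, ?_⟩
  filter_upwards [h1, h2] with t h1 h2
  push_cast
  rw [h1, h2]

lemma affine_mul (c d : ℝ) (hJ : HasContinuation S J) :
    HasContinuation S (fun t => (c + t * d) * J t) := by
  obtain ⟨H, hH, h1⟩ := hJ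
  refine ⟨fun z => (c + z * d) * H z, DifferentiableOn.mul (by fun_prop) hH, ?_⟩
  filter_upwards [h1] with t h1
  push_cast
  rw [h1]

lemma const_mul (c : ℝ) (hJ : HasContinuation S J) : HasContinuation S (fun t => c * J t) := by
  simpa using hJ.affine_mul c 0

lemma zero : HasContinuation S (fun _ => 0) := ⟨fun _ => 0, by fun_prop, by simp⟩

end HasContinuation

/-- Smooth functions with compact support in `U`. -/
structure IsTestFunction {n : ℕ} (U : Set (Fin n → ℝ)) (φ : (Fin n → ℝ) → ℝ) : Prop where
  contDiff : ContDiff ℝ (⊤ : ℕ∞) φ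
  hasCompactSupport : HasCompactSupport φ
  tsupport_subset : tsupport φ ⊆ U

namespace IsTestFunction

variable {n : ℕ} {U : Set (Fin n → ℝ)} {φ : (Fin n → ℝ) → ℝ}

lemma integrable_mul (hφ : IsTestFunction U φ) {h : (Fin n → ℝ) → ℝ} (hh : Continuous h) :
    Integrable (fun x => φ x * h x) :=
  (hφ.contDiff.continuous.mul hh).integrable_of_hasCompactSupport hφ.hasCompactSupport.mul_right

lemma mul_coord (hφ : IsTestFunction U φ) (i : Fin n) : IsTestFunction U (fun x => φ x * x i) where
  contDiff := hφ.contDiff.mul (contDiff_apply ℝ ℝ i)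
  hasCompactSupport := hφ.hasCompactSupport.mul_right
  tsupport_subset := (tsupport_mul_subset_left).trans hφ.tsupport_subset

lemma fderiv_apply (hφ : IsTestFunction U φ) (v : Fin n → ℝ) :
    IsTestFunction U (fun x => fderiv ℝ φ x v) where
  contDiff := (hφ.contDiff.fderiv_right (m := (⊤ : ℕ∞)) (by simp)).clm_apply contDiff_const
  hasCompactSupport := hφ.hasCompactSupport.fderiv_apply ℝ v
  tsupport_subset := (tsupport_fderiv_apply_subset ℝ v).trans hφ.tsupport_subset

end IsTestFunction

/-- The exponent vector `-λ + t·a`. -/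
def lineExp {r : ℕ} (lam : Fin r → ℝ) (a : Fin r → ℕ) (t : ℝ) (j : Fin r) : ℝ :=
  -lam j + t * a j

lemma eventually_lt_lineExp {r : ℕ} (lam : Fin r → ℝ) {a : Fin r → ℕ} (ha : ∀ j, 1 ≤ a j)
    (M : ℝ) : ∀ᶠ t in atTop, ∀ j, M < lineExp lam a t j := by
  refine eventually_all.mpr fun j => ?_
  have : (0 : ℝ) < a j := by exact_mod_cast ha j
  exact (tendsto_atTop_add_const_left _ _
    (tendsto_id.atTop_mul_const this)).eventually_gt_atTop M

section Continuation

variable {n r : ℕ} (f : Fin r → MvPolynomial (Fin n) ℝ) (lam : Fin r → ℝ) (a : Fin r → ℕ)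
  (S : Set ℂ) (U : Set (Fin n → ℝ))

/-- All integrals of `G / (f_1⋯f_r)^k · |F|^{-λ+ta}` against test functions on `U` continue
holomorphically in `t` to `S`. -/
def PairingsContinue (k : ℕ) (G : XS ℝ n r) : Prop :=
  ∀ φ, IsTestFunction U φ →
    HasContinuation S fun t => ∫ x, φ x * twistedVal f (lineExp lam a t) k G x

namespace PairingsContinue

variable {f lam a S U} {k : ℕ} {G G' : XS ℝ n r}

lemma add (ha : ∀ j, 1 ≤ a j) (hG : PairingsContinue f lam a S U k G)
    (hG' : PairingsContinue f lam a S U k G') : PairingsContinue f lam a S U k (G + G') := by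
  intro φ hφ
  refine ((hG φ hφ).add (hG' φ hφ)).congr ?_
  filter_upwards [eventually_lt_lineExp lam ha (k + 1)] with t ht
  rw [← integral_add (hφ.integrable_mul (continuous_twistedVal ht _))
    (hφ.integrable_mul (continuous_twistedVal ht _))]
  simp only [twistedVal, map_add, add_mul, mul_add]

lemma mul (ha : ∀ j, 1 ≤ a j) (hG : PairingsContinue f lam a S U k G) (p : XS ℝ n r) :
    PairingsContinue f lam a S U k (p * G) := by
  induction p using MvPolynomial.induction_on with
  | C c =>
    intro φ hφ
    refine ((hG φ hφ).const_mul c).congr (Eventually.of_forall fun t => ?_)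
    simp only [← integral_const_mul, twistedVal, map_mul, eval_C]
    congr 1; ext x; ring
  | add p q hp hq => rw [add_mul]; exact hp.add ha hq
  | mul_X p l hp =>
    intro φ hφ
    rcases l with i | j
    · refine (hp _ (hφ.mul_coord i)).congr (Eventually.of_forall fun t => ?_)
      simp only [twistedVal, map_mul, eval_X, Sum.elim_inl]
      congr 1; ext x; ring
    · refine ((hp _ hφ).affine_mul (-lam j) (a j)).congr (Eventually.of_forall fun t => ?_)
      simp only [← integral_const_mul, twistedVal, map_mul, eval_X, Sum.elim_inr, lineExp]
      congr 1; ext x; ring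

lemma mul_pxProd_pow (ha : ∀ j, 1 ≤ a j) (hG : PairingsContinue f lam a S U k G) (m : ℕ) :
    PairingsContinue f lam a S U (k + m) (G * pxProd f ^ m) := by
  intro φ hφ
  refine (hG φ hφ).congr ?_
  filter_upwards [eventually_lt_lineExp lam ha 0] with t ht
  simp only [twistedVal_mul_pxProd_pow (fun j => (ht j).ne')]

lemma nablaNum (ha : ∀ j, 1 ≤ a j) (hG : PairingsContinue f lam a S U k G) (i : Fin n) :
    PairingsContinue f lam a S U (k + 1) (nablaNum f i k G) := by
  intro φ hφ
  refine ((hG _ (hφ.fderiv_apply (Pi.single i 1))).const_mul (-1)).congr ?_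
  filter_upwards [eventually_lt_lineExp lam ha (k + 2)] with t ht
  have ht1 (j) : (k : ℝ) + 1 < lineExp lam a t j := by linarith [ht j]
  have ht2 (j) : ((k + 1 : ℕ) : ℝ) + 1 < lineExp lam a t j := by push_cast; linarith [ht j]
  rw [neg_one_mul]
  exact (integral_bilinear_hasLineDerivAt_right_eq_neg_left_of_integrable
    (B := ContinuousLinearMap.mul ℝ ℝ) (v := Pi.single i 1)
    ((hφ.fderiv_apply _).integrable_mul (continuous_twistedVal ht1 _))
    (hφ.integrable_mul (continuous_twistedVal ht2 _))
    (hφ.integrable_mul (continuous_twistedVal ht1 _))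
    (fun x _ => ((hφ.contDiff.differentiable (by simp)) x).hasFDerivAt.hasLineDerivAt _)
    (fun x _ => hasLineDerivAt_twistedVal ht1 G i x)).symm

end PairingsContinue

/-- The submodule of fractions `G / (f_1⋯f_r)^k` all of whose pairings with test functions on `U`
continue holomorphically to `S`. -/
def continuationSubmodule (ha : ∀ j, 1 ≤ a j) : Submodule (XS ℝ n r) (Frac ℝ n r) where
  carrier := {g | ∃ k G, g * toF ℝ n r (pxProd f) ^ k = toF ℝ n r G ∧
    PairingsContinue f lam a S U k G}
  zero_mem' := ⟨0, 0, by simp [toF], fun φ _ => by simpa [twistedVal] using HasContinuation.zero⟩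
  add_mem' := by
    rintro g g' ⟨k, G, hg, hG⟩ ⟨k', G', hg', hG'⟩
    refine ⟨k + k', G * pxProd f ^ k' + G' * pxProd f ^ k, ?_,
      (hG.mul_pxProd_pow ha k').add ha (by rw [add_comm]; exact hG'.mul_pxProd_pow ha k)⟩
    simp only [toF, map_add, map_mul, map_pow] at hg hg' ⊢
    rw [← hg, ← hg']
    ring
  smul_mem' := by
    rintro p g ⟨k, G, hg, hG⟩
    refine ⟨k, p * G, ?_, hG.mul ha p⟩
    rw [smul_mul_assoc, hg, Algebra.smul_def]
    simp [toF]

variable {f lam a S U}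

/-- The Bernstein–Sato functional equation, integrated against a test function. -/
lemma hasContinuation_of_mem_BS (hf : ∀ j, f j ≠ 0) (ha : ∀ j, 1 ≤ a j)
    (h0 : PairingsContinue f lam a S U 0 (∏ j, px ℝ n r (f j) ^ a j))
    {b : MvPolynomial (Fin r) ℝ} (hb : b ∈ BS ℝ n r f a) {φ : (Fin n → ℝ) → ℝ}
    (hφ : IsTestFunction U φ) :
    HasContinuation S fun t => eval (lineExp lam a t) b *
      ∫ x, φ x * ∏ j, |eval x (f j)| ^ lineExp lam a t j := by
  have hle : Na ℝ n r f a ≤ continuationSubmodule f lam a S U ha := by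
    refine sInf_le ⟨⟨0, _, by simp [Fsa], h0⟩, ?_⟩
    rintro i g ⟨k, G, hg, hG⟩
    exact ⟨k + 1, _, nabla_mul_pxProd_pow hf i hg, hG.nablaNum ha i⟩
  obtain ⟨k, G, hg, hG⟩ := hle hb
  have hG' : G = ps ℝ n r b * pxProd f ^ k :=
    toF_injective ℝ n r (by rw [← hg]; simp [toF])
  refine (hG φ hφ).congr ?_
  filter_upwards [eventually_lt_lineExp lam ha 0] with t ht
  rw [← integral_const_mul, hG']
  refine integral_congr_ae (Eventually.of_forall fun x => ?_)
  have := twistedVal_mul_pxProd_pow (f := f) (k := 0) (fun j => (ht j).ne') (ps ℝ n r b) k x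
  rw [zero_add] at this
  beta_reduce
  rw [this]
  simp only [twistedVal, eval_ps, regPow, pow_zero, inv_one, mul_one]
  ring

end Continuation

section WithDensity

variable {Ω : Type*} [MeasurableSpace Ω] {μ : Measure Ω} {v X : Ω → ℝ}

lemma integrable_exp_withDensity_iff (hv : Measurable v) (hv0 : ∀ x, 0 ≤ v x) (t : ℝ) :
    Integrable (fun x => Real.exp (t * X x)) (μ.withDensity fun x => ENNReal.ofReal (v x)) ↔
      Integrable (fun x => v x * Real.exp (t * X x)) μ := by
  rw [integrable_withDensity_iff_integrable_smul' hv.ennreal_ofReal (by simp)]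
  simp [ENNReal.toReal_ofReal (hv0 _)]

lemma mgf_withDensity (hv : Measurable v) (hv0 : ∀ x, 0 ≤ v x) (t : ℝ) :
    mgf X (μ.withDensity fun x => ENNReal.ofReal (v x)) t =
      ∫ x, v x * Real.exp (t * X x) ∂μ := by
  rw [mgf, integral_withDensity_eq_integral_toReal_smul hv.ennreal_ofReal (by simp)]
  simp [ENNReal.toReal_ofReal (hv0 _)]

lemma mem_interior_integrableExpSet_of_lt {s t : ℝ} (hs : s ∈ integrableExpSet X μ)
    (hev : ∀ᶠ t in atTop, t ∈ integrableExpSet X μ) (hst : s < t) :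
    t ∈ interior (integrableExpSet X μ) := by
  refine mem_interior.mpr ⟨Set.Ioi s, fun u hu => ?_, isOpen_Ioi, hst⟩
  obtain ⟨w, hw, huw⟩ := (hev.and (eventually_ge_atTop u)).exists
  exact integrable_exp_mul_of_le_of_le hs hw (le_of_lt hu) huw

lemma hasContinuation_integral_of_nonneg (hv : Measurable v) (hv0 : ∀ x, 0 ≤ v x) {s : ℝ}
    (hs : Integrable (fun x => v x * Real.exp (s * X x)) μ)
    (hev : ∀ᶠ t in atTop, Integrable (fun x => v x * Real.exp (t * X x)) μ) :
    HasContinuation {z | s < z.re} fun t => ∫ x, v x * Real.exp (t * X x) ∂μ := by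
  simp only [← integrable_exp_withDensity_iff hv hv0] at hs hev
  refine ⟨complexMGF X (μ.withDensity fun x => ENNReal.ofReal (v x)),
    differentiableOn_complexMGF.mono fun z hz => mem_interior_integrableExpSet_of_lt hs hev hz,
    Eventually.of_forall fun t => ?_⟩
  rw [complexMGF_ofReal, mgf_withDensity hv hv0]

lemma hasContinuation_integral (hv : Measurable v) (hX : Measurable X) {s : ℝ}
    (hs : Integrable (fun x => v x * Real.exp (s * X x)) μ)
    (hev : ∀ᶠ t in atTop, Integrable (fun x => v x * Real.exp (t * X x)) μ) :
    HasContinuation {z | s < z.re} fun t => ∫ x, v x * Real.exp (t * X x) ∂μ := by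
  have hpos {u : Ω → ℝ} (hu : Measurable u) {t : ℝ}
      (h : Integrable (fun x => u x * Real.exp (t * X x)) μ) :
      Integrable (fun x => max (u x) 0 * Real.exp (t * X x)) μ := by
    refine h.mono (by fun_prop) (Eventually.of_forall fun x => ?_)
    rw [norm_mul, norm_mul]
    gcongr
    rw [Real.norm_eq_abs, Real.norm_eq_abs, abs_of_nonneg (le_max_right _ _)]
    exact max_le (le_abs_self _) (abs_nonneg _)
  have hneg {t : ℝ} (h : Integrable (fun x => v x * Real.exp (t * X x)) μ) :
      Integrable (fun x => -v x * Real.exp (t * X x)) μ := by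
    simpa only [neg_mul] using! h.neg
  have h1 := hasContinuation_integral_of_nonneg (X := X) (μ := μ) (hv.max measurable_const)
    (fun x => le_max_right _ _) (hpos hv hs) (hev.mono fun t ht => hpos hv ht)
  have h2 := hasContinuation_integral_of_nonneg (X := X) (μ := μ) (hv.neg.max measurable_const)
    (fun x => le_max_right _ _) (hpos hv.neg (hneg hs))
    (hev.mono fun t ht => hpos hv.neg (hneg ht))
  refine (h1.add (h2.const_mul (-1))).congr ?_
  filter_upwards [hev] with t ht
  rw [neg_one_mul, ← sub_eq_add_neg, ← integral_sub (hpos hv ht) (hpos hv.neg (hneg ht))]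
  refine integral_congr_ae (Eventually.of_forall fun x => ?_)
  beta_reduce
  rw [← sub_mul, Pi.neg_apply, max_zero_sub_max_neg_zero_eq_self]

end WithDensity

/-- A test function on `U` may be multiplied with a function that is integrable on `U`. -/
lemma IsTestFunction.integrable_mul_of_integrableOn {n : ℕ} {U : Set (Fin n → ℝ)}
    {φ h : (Fin n → ℝ) → ℝ} (hφ : IsTestFunction U φ) (hh : IntegrableOn h U) :
    Integrable (fun x => φ x * h x) := by
  obtain ⟨C, hC⟩ := hφ.hasCompactSupport.exists_bound_of_continuous hφ.contDiff.continuous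
  have h1 : IntegrableOn (fun x => φ x * h x) U :=
    Integrable.bdd_mul hh hφ.contDiff.continuous.aestronglyMeasurable (Eventually.of_forall hC)
  refine (integrableOn_iff_integrable_of_support_subset fun x hx => ?_).mp h1
  exact hφ.tsupport_subset (subset_tsupport φ (left_ne_zero_of_mul hx))

section Weight

variable {n r : ℕ} (f : Fin r → MvPolynomial (Fin n) ℝ) (lam : Fin r → ℝ) (a : Fin r → ℕ)

/-- The function `∏ |f_j|^{-λ_j}`. -/
def weight (x : Fin n → ℝ) : ℝ := ∏ j, |eval x (f j)| ^ (-lam j)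

/-- The function `log |f_1^{a_1}⋯f_r^{a_r}|`. -/
def logProd (x : Fin n → ℝ) : ℝ := ∑ j, a j * Real.log |eval x (f j)|

lemma measurable_weight : Measurable (weight f lam) :=
  Finset.measurable_fun_prod _ fun j _ =>
    ((MvPolynomial.continuous_eval (f j)).measurable.abs).pow_const _

lemma measurable_logProd : Measurable (logProd f a) :=
  Finset.measurable_fun_sum _ fun j _ =>
    ((MvPolynomial.continuous_eval (f j)).measurable.abs.log).const_mul _

lemma weight_nonneg (x : Fin n → ℝ) : 0 ≤ weight f lam x :=
  Finset.prod_nonneg fun _ _ => by positivity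

variable {f}

lemma ae_eval_ne_zero (hf : ∀ j, f j ≠ 0) : ∀ᵐ x : Fin n → ℝ, ∀ j, eval x (f j) ≠ 0 :=
  ae_all_iff.mpr fun j => by
    simpa [ae_iff] using MvPolynomial.volume_zeros_eq_zero (hf j)

lemma prod_rpow_lineExp {x : Fin n → ℝ} (hx : ∀ j, eval x (f j) ≠ 0) (t : ℝ) :
    ∏ j, |eval x (f j)| ^ lineExp lam a t j =
      weight f lam x * Real.exp (t * logProd f a x) := by
  rw [weight, logProd, Finset.mul_sum, Real.exp_sum, ← Finset.prod_mul_distrib]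
  refine Finset.prod_congr rfl fun j _ => ?_
  have h := abs_pos.mpr (hx j)
  rw [lineExp, Real.rpow_add h, Real.rpow_def_of_pos h (t * a j)]
  congr 2
  ring

lemma exp_logProd {x : Fin n → ℝ} (hx : ∀ j, eval x (f j) ≠ 0) :
    Real.exp (logProd f a x) = |∏ j, eval x (f j) ^ a j| := by
  rw [logProd, Real.exp_sum, Finset.abs_prod]
  refine Finset.prod_congr rfl fun j _ => ?_
  rw [abs_pow, ← Real.rpow_natCast, Real.rpow_def_of_pos (abs_pos.mpr (hx j)), mul_comm]

variable {lam a}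

lemma integrable_mul_weight_mul_exp (hf : ∀ j, f j ≠ 0) (ha : ∀ j, 1 ≤ a j)
    {U : Set (Fin n → ℝ)} {φ : (Fin n → ℝ) → ℝ} (hφ : IsTestFunction U φ)
    (p : MvPolynomial (Fin n) ℝ) :
    ∀ᶠ t in atTop, Integrable fun x =>
      φ x * eval x p * weight f lam x * Real.exp (t * logProd f a x) := by
  filter_upwards [eventually_lt_lineExp lam ha 1] with t ht
  have hc := continuous_twistedVal (f := f) (k := 0) (s := lineExp lam a t) (by simpa using ht)
    (px ℝ n r p)
  refine (hφ.integrable_mul hc).congr ?_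
  filter_upwards [ae_eval_ne_zero hf] with x hx
  simp only [twistedVal, eval_px, regPow, pow_zero, inv_one, mul_one, prod_rpow_lineExp lam a hx]
  ring

/-- The pairings of `F^{s+a}` continue one unit further to the left than those of `F^s`. -/
lemma pairingsContinue_Fsa (hf : ∀ j, f j ≠ 0) (ha : ∀ j, 1 ≤ a j) {U : Set (Fin n → ℝ)}
    {δ : ℝ} (hU : IntegrableOn (fun x => weight f lam x * Real.exp (δ * logProd f a x)) U) :
    PairingsContinue f lam a {z | δ - 1 < z.re} U 0 (∏ j, px ℝ n r (f j) ^ a j) := by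
  intro φ hφ
  have hev := integrable_mul_weight_mul_exp (lam := lam) hf ha hφ (∏ j, f j ^ a j)
  have hmeas : Measurable fun x => φ x * eval x (∏ j, f j ^ a j) * weight f lam x :=
    (hφ.contDiff.continuous.measurable.mul (MvPolynomial.continuous_eval _).measurable).mul
      (measurable_weight f lam)
  have hX := measurable_logProd f a
  have hs : Integrable fun x => φ x * eval x (∏ j, f j ^ a j) * weight f lam x *
      Real.exp ((δ - 1) * logProd f a x) := by
    refine (hφ.integrable_mul_of_integrableOn hU).mono (by fun_prop) ?_
    filter_upwards [ae_eval_ne_zero hf] with x hx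
    have h1 : Real.exp (δ * logProd f a x) =
        Real.exp ((δ - 1) * logProd f a x) * |eval x (∏ j, f j ^ a j)| := by
      have := exp_logProd a hx
      simp only [map_prod, map_pow, ← this, ← Real.exp_add]
      congr 1
      ring
    rw [h1]
    simp only [norm_mul, Real.norm_eq_abs, abs_abs]
    exact le_of_eq (by ring)
  refine (hasContinuation_integral hmeas hX hs hev).congr (Eventually.of_forall fun t => ?_)
  refine integral_congr_ae ?_
  filter_upwards [ae_eval_ne_zero hf] with x hx
  simp only [twistedVal, map_prod, map_pow, eval_px, regPow, pow_zero, inv_one, mul_one,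
    prod_rpow_lineExp lam a hx]
  ring

end Weight

section Polynomial

variable {r : ℕ}

lemma differentiable_aeval_line (u w : Fin r → ℂ) (b : MvPolynomial (Fin r) ℝ) :
    Differentiable ℂ fun z : ℂ => aeval (fun j => u j + z * w j) b := by
  induction b using MvPolynomial.induction_on with
  | C c => simp
  | add p q hp hq => simpa using! hp.add hq
  | mul_X p j hp => simpa using! hp.mul (by fun_prop : Differentiable ℂ fun z => u j + z * w j)

lemma aeval_lineExp (lam : Fin r → ℝ) (a : Fin r → ℕ) (b : MvPolynomial (Fin r) ℝ) (t : ℝ) :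
    aeval (fun j => -(lam j : ℂ) + t * (a j : ℂ)) b = ((eval (lineExp lam a t) b : ℝ) : ℂ) := by
  have := MvPolynomial.aeval_algebraMap_apply (A := ℝ) (B := ℂ) (lineExp lam a t) b
  rw [MvPolynomial.aeval_eq_eval] at this
  convert! this using 2
  congr 1
  ext j
  simp [lineExp]

end Polynomial

section Main

variable {n r : ℕ} {f : Fin r → MvPolynomial (Fin n) ℝ} {lam : Fin r → ℝ} {a : Fin r → ℕ}

/-- If `b` lies in the Bernstein–Sato ideal and `b` has no zero on the complex line
`-λ + z·a` for `|z| < 5δ`, then local integrability at `z = δ` propagates to `z = 0`. -/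
lemma integrable_mul_weight_of_mem_BS (hf : ∀ j, f j ≠ 0) (ha : ∀ j, 1 ≤ a j)
    {b : MvPolynomial (Fin r) ℝ} (hb : b ∈ BS ℝ n r f a) {δ : ℝ} (hδ : 0 < δ) (hδ1 : 5 * δ ≤ 1)
    (hbδ : ∀ z : ℂ, ‖z‖ < 5 * δ → aeval (fun j => -(lam j : ℂ) + z * (a j : ℂ)) b ≠ 0)
    {U : Set (Fin n → ℝ)}
    (hU : IntegrableOn (fun x => weight f lam x * Real.exp (δ * logProd f a x)) U)
    {φ : (Fin n → ℝ) → ℝ} (hφ : IsTestFunction U φ) (hφ0 : ∀ x, 0 ≤ φ x) :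
    Integrable fun x => φ x * weight f lam x := by
  obtain ⟨J, hJ, hJev⟩ := hasContinuation_of_mem_BS hf ha (pairingsContinue_Fsa hf ha hU) hb hφ
  set pC : ℂ → ℂ := fun z => aeval (fun j => -(lam j : ℂ) + z * (a j : ℂ)) b with hpC
  have hpCd : Differentiable ℂ pC := differentiable_aeval_line _ _ b
  set v : (Fin n → ℝ) → ℝ := fun x => φ x * weight f lam x with hv
  have hvm : Measurable v := hφ.contDiff.continuous.measurable.mul (measurable_weight f lam)
  have hv0 (x) : 0 ≤ v x := mul_nonneg (hφ0 x) (weight_nonneg f lam x)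
  set μ : Measure (Fin n → ℝ) := volume.withDensity fun x => ENNReal.ofReal (v x) with hμ
  set Y := logProd f a
  have hev : ∀ᶠ t in atTop, t ∈ integrableExpSet Y μ := by
    filter_upwards [integrable_mul_weight_mul_exp (lam := lam) hf ha hφ 1] with t ht
    refine (integrable_exp_withDensity_iff hvm hv0 t).mpr ?_
    simpa [hv] using ht
  have hδm : δ ∈ integrableExpSet Y μ := by
    refine (integrable_exp_withDensity_iff hvm hv0 δ).mpr ?_
    simpa only [hv, mul_assoc] using hφ.integrable_mul_of_integrableOn hU
  have hint {t : ℝ} (ht : δ < t) : t ∈ interior (integrableExpSet Y μ) :=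
    mem_interior_integrableExpSet_of_lt hδm hev ht
  have hopen (c : ℝ) : IsOpen {z : ℂ | c < z.re} := isOpen_lt continuous_const Complex.continuous_re
  have heq : Set.EqOn (fun z => pC z * complexMGF Y μ z) J {z | δ < z.re} := by
    have hI : DifferentiableOn ℂ (complexMGF Y μ) {z | δ < z.re} :=
      differentiableOn_complexMGF.mono fun z hz => hint hz
    obtain ⟨T, hT⟩ := eventually_atTop.mp hJev
    set t₀ := max T δ + 1
    have hmem : (t₀ : ℂ) ∈ {z : ℂ | δ < z.re} := by
      simp only [Set.mem_ofPred_eq, Complex.ofReal_re]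
      linarith [le_max_right T δ]
    refine ((hpCd.differentiableOn.mul hI).analyticOnNhd (hopen δ)).eqOn_of_preconnected_of_frequently_eq
      ((hJ.mono fun z hz => ?_).analyticOnNhd (hopen δ))
      (convex_halfSpace_re_gt δ).isPreconnected hmem ?_
    · simp only [Set.mem_ofPred_eq] at hz ⊢
      linarith
    · have htend : Tendsto (fun t : ℝ => (t : ℂ)) (𝓝[>] t₀) (𝓝[≠] (t₀ : ℂ)) := by
        refine tendsto_nhdsWithin_iff.mpr
          ⟨(Complex.continuous_ofReal.tendsto t₀).mono_left nhdsWithin_le_nhds, ?_⟩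
        filter_upwards [self_mem_nhdsWithin] with t ht
        simpa using (ne_of_gt ht : t ≠ t₀)
      refine htend.frequently (Eventually.frequently ?_)
      filter_upwards [self_mem_nhdsWithin] with t ht
      have hTt : T ≤ t := by
        have : t₀ < t := ht
        linarith [le_max_left T δ]
      rw [← hT t hTt]
      rw [Pi.mul_apply, complexMGF_ofReal, hμ, mgf_withDensity hvm hv0]
      simp only [hpC, aeval_lineExp]
      push_cast
      congr 2
      refine integral_congr_ae ?_
      filter_upwards [ae_eval_ne_zero hf] with x hx
      rw [prod_rpow_lineExp lam a hx, hv, mul_assoc]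
  have hball (z : ℂ) (hz : z ∈ Metric.ball ((2 * δ : ℝ) : ℂ) (5 / 2 * δ)) :
      pC z ≠ 0 ∧ δ - 1 < z.re := by
    rw [Metric.mem_ball, dist_eq_norm] at hz
    constructor
    · refine hbδ z ?_
      calc ‖z‖ = ‖(z - ((2 * δ : ℝ) : ℂ)) + ((2 * δ : ℝ) : ℂ)‖ := by rw [sub_add_cancel]
        _ ≤ ‖z - ((2 * δ : ℝ) : ℂ)‖ + ‖((2 * δ : ℝ) : ℂ)‖ := norm_add_le _ _
        _ < 5 / 2 * δ + 2 * δ := by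
          rw [Complex.norm_real, Real.norm_of_nonneg (by linarith)]
          linarith
        _ ≤ 5 * δ := by linarith
    · have := (abs_le.mp ((Complex.abs_re_le_norm _).trans hz.le)).1
      simp only [Complex.sub_re, Complex.ofReal_re] at this
      linarith
  have hG : DifferentiableOn ℂ (fun z => J z / pC z)
      (Metric.ball ((2 * δ : ℝ) : ℂ) (5 / 2 * δ)) :=
    (hJ.mono fun z hz => (hball z hz).2).div hpCd.differentiableOn fun z hz => (hball z hz).1
  have hloc : (fun z => J z / pC z) =ᶠ[𝓝 ((2 * δ : ℝ) : ℂ)] complexMGF Y μ := by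
    have h1 : ((2 * δ : ℝ) : ℂ) ∈ {z : ℂ | δ < z.re} := by
      simp only [Set.mem_ofPred_eq, Complex.ofReal_re]
      linarith
    filter_upwards [(hopen δ).mem_nhds h1, Metric.ball_mem_nhds _ (by linarith : 0 < 5 / 2 * δ)]
      with z hz hz'
    rw [← heq hz, mul_div_cancel_left₀ _ (hball z hz').1]
  have hfin := integrable_exp_of_complexMGF_continuation hG (hint (by linarith)) hloc
    (by linarith : 0 ≤ 2 * δ) (by linarith)
  rw [hμ, integrable_exp_withDensity_iff hvm hv0] at hfin
  simpa using hfin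

/-- Local integrability of `∏ |f_j|^{-λ_j + ε_j}` for all `ε > 0` implies that of
`∏ |f_j|^{-λ_j}`, unless every Bernstein–Sato polynomial vanishes at `-λ`. -/
lemma integrableNearR_of_mem_BS (hf : ∀ j, f j ≠ 0) (ha : ∀ j, 1 ≤ a j) {x₀ : Fin n → ℝ}
    (h1 : ∀ ε : Fin r → ℝ, (∀ j, 0 < ε j) →
      IntegrableNearR n (fun x => ∏ j, |eval x (f j)| ^ (-(lam j - ε j))) x₀)
    {b : MvPolynomial (Fin r) ℝ} (hb : b ∈ BS ℝ n r f a) (hb0 : eval (fun j => -lam j) b ≠ 0) :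
    IntegrableNearR n (weight f lam) x₀ := by
  obtain ⟨ε, hε, hεb⟩ : ∃ ε > 0, ∀ z : ℂ, ‖z‖ < ε →
      aeval (fun j => -(lam j : ℂ) + z * (a j : ℂ)) b ≠ 0 := by
    have h0 := aeval_lineExp lam a b 0
    have hc := (differentiable_aeval_line (fun j => -(lam j : ℂ)) (fun j => (a j : ℂ)) b).continuous
    have hne := hc.continuousAt.eventually_ne (x := (0 : ℂ)) (y := 0) (by
      simp only [Complex.ofReal_zero] at h0
      rw [h0]
      have : lineExp lam a 0 = fun j => -lam j := by ext j; simp [lineExp]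
      simpa [this] using hb0)
    obtain ⟨ε, hε, h⟩ := Metric.eventually_nhds_iff.mp hne
    exact ⟨ε, hε, fun z hz => h (by simpa using hz)⟩
  set δ := min ε 1 / 5
  have hδ : 0 < δ := by positivity
  have hδε : 5 * δ = min ε 1 := by ring
  obtain ⟨U, hUo, hxU, hU⟩ := h1 (fun j => δ * a j) fun j => by
    have : (0 : ℝ) < a j := by exact_mod_cast ha j
    positivity
  have hU' : IntegrableOn (fun x => weight f lam x * Real.exp (δ * logProd f a x)) U := by
    refine hU.congr_fun_ae (ae_restrict_of_ae ?_)
    filter_upwards [ae_eval_ne_zero hf] with x hx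
    rw [← prod_rpow_lineExp lam a hx]
    simp only [lineExp]
    congr! 2
    ring
  obtain ⟨φ, hφU, hφc, hφs, hφr, hφx⟩ := exists_contDiff_tsupport_subset (n := ⊤) (hUo.mem_nhds hxU)
  have hφ0 (x) : 0 ≤ φ x := (hφr (Set.mem_range_self x)).1
  have key := integrable_mul_weight_of_mem_BS hf ha hb hδ (by rw [hδε]; exact min_le_right _ _)
    (fun z hz => hεb z (hz.trans_le (by rw [hδε]; exact min_le_left _ _))) hU'
    ⟨hφs, hφc, hφU⟩ hφ0
  refine ⟨{x | 1 / 2 < φ x}, isOpen_lt continuous_const hφs.continuous, by simp [hφx]; norm_num, ?_⟩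
  refine (key.const_mul 2).integrableOn.mono' (measurable_weight f lam).aestronglyMeasurable ?_
  refine (ae_restrict_iff' (isOpen_lt continuous_const hφs.continuous).measurableSet).mpr
    (Eventually.of_forall fun x hx => ?_)
  have hx' : 1 / 2 < φ x := hx
  have := weight_nonneg f lam x
  rw [Real.norm_of_nonneg this]
  nlinarith

end Main

end

/-- Real LCT-polytope roots: if `a_j ≥ 1` for all `j`, `∏|f_j|^{-(λ_j-ε_j)}` is integrable near
`x₀` for all `ε > 0` but `∏|f_j|^{-λ_j}` is not, then every `b` in the real Bernstein–Sato
ideal `B_{F,ℝ}^a` vanishes at `(-λ₁,…,-λ_r)`. -/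
theorem stmt8 (n r : ℕ) (hn : 1 ≤ n) (hr : 1 ≤ r)
    (f : Fin r → MvPolynomial (Fin n) ℝ) (hf : ∀ j, f j ≠ 0)
    (a : Fin r → ℕ) (hfa : ∀ c : ℝ, (∏ j, f j ^ a j) ≠ C c) (ha : ∀ j, 1 ≤ a j)
    (lam : Fin r → ℝ) (hlam : ∀ j, 0 ≤ lam j) (x₀ : Fin n → ℝ)
    (h1 : ∀ ε : Fin r → ℝ, (∀ j, 0 < ε j) →
      IntegrableNearR n (fun x =>
        ∏ j, |eval x (f j)| ^ (-(lam j - ε j))) x₀)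
    (h2 : ¬ IntegrableNearR n (fun x =>
        ∏ j, |eval x (f j)| ^ (-(lam j))) x₀) :
    ∀ b ∈ BS ℝ n r f a, eval (fun j => -(lam j)) b = 0 := by
  intro b hb
  by_contra hb0
  exact h2 (integrableNearR_of_mem_BS hf ha h1 hb hb0)

end
end
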